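/- For every u ∈ C₀^∞(B⁴), the Hardy–Rellich type inequality ∫_{B⁴} |Δu(x)|² dx ≥ 9 ∫_{B⁴} u(x)²/(1 − |x|²)⁴ dx holds. -/

import Mathlib

open MeasureTheory Real

noncomputable section

/-- The Euclidean space `ℝ⁴`. -/
abbrev E4 := EuclideanSpace ℝ (Fin 4)

/-- The Euclidean Laplacian on `ℝ⁴`. -/
def lapE (u : E4 → ℝ) (x : E4) : ℝ :=
  ∑ i, fderiv ℝ (fun y => fderiv ℝ u y (EuclideanSpace.single i 1)) x (EuclideanSpace.single i 1)

end

noncomputable section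

/-- The partial derivative `∂ᵢ u`. -/
def partialDeriv (i : Fin 4) (u : E4 → ℝ) (x : E4) : ℝ :=
  fderiv ℝ u x (EuclideanSpace.single i 1)

/-- The conformal factor `2 / (1 - |x|²)` of the Poincaré ball model of hyperbolic space. -/
def conformalFactor (x : E4) : ℝ := 2 / (1 - ‖x‖ ^ 2)

/-- The vector field whose divergence is, up to a nonnegative remainder, the difference of the
two integrands in the Hardy–Rellich inequality. -/
def rellichField (u : E4 → ℝ) (i : Fin 4) (x : E4) : ℝ :=
  -(4 * conformalFactor x * (∑ j, x j * partialDeriv j u x) * partialDeriv i u x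
    - 2 * conformalFactor x * (∑ j, partialDeriv j u x ^ 2) * x i
    + 9 / 2 * conformalFactor x ^ 2 * u x * partialDeriv i u x
    + 15 / 4 * conformalFactor x ^ 3 * u x ^ 2 * x i)

theorem lapE_eq_sum_partialDeriv (u : E4 → ℝ) (x : E4) :
    lapE u x = ∑ i, partialDeriv i (partialDeriv i u) x := rfl

theorem one_sub_norm_sq_pos {x : E4} (hx : x ∈ Metric.ball (0 : E4) 1) : 0 < 1 - ‖x‖ ^ 2 := by
  have h : ‖x‖ < 1 := by simpa using hx
  nlinarith [norm_nonneg x]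

theorem contDiff_partialDeriv {u : E4 → ℝ} (hu : ContDiff ℝ (⊤ : ℕ∞) u) (i : Fin 4) :
    ContDiff ℝ (⊤ : ℕ∞) (partialDeriv i u) :=
  (hu.fderiv_right (m := (⊤ : ℕ∞)) (by simp)).clm_apply contDiff_const

theorem partialDeriv_comm {u : E4 → ℝ} (hu : ContDiff ℝ (⊤ : ℕ∞) u) (i j : Fin 4) (x : E4) :
    partialDeriv i (partialDeriv j u) x = partialDeriv j (partialDeriv i u) x := by
  have hd : DifferentiableAt ℝ (fderiv ℝ u) x :=
    (hu.fderiv_right (m := (⊤ : ℕ∞)) (by simp)).differentiable (by simp) x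
  have key : ∀ a b : Fin 4, partialDeriv a (partialDeriv b u) x
      = fderiv ℝ (fderiv ℝ u) x (EuclideanSpace.single a 1) (EuclideanSpace.single b 1) := by
    intro a b
    unfold partialDeriv
    rw [fderiv_clm_apply hd (differentiableAt_const _)]
    simp
  rw [key, key]
  exact (hu.contDiffAt.isSymmSndFDerivAt (by
    rw [minSmoothness_of_isRCLikeNormedField]
    exact WithTop.coe_le_coe.mpr le_top)) _ _

theorem partialDeriv_eq_zero_of_notMem_tsupport {u : E4 → ℝ} {x : E4} (hx : x ∉ tsupport u)
    (i : Fin 4) : partialDeriv i u x = 0 := by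
  simp [partialDeriv, fderiv_of_notMem_tsupport ℝ hx]

theorem contDiffAt_conformalFactor {x : E4} (hx : x ∈ Metric.ball (0 : E4) 1) :
    ContDiffAt ℝ (⊤ : ℕ∞) conformalFactor x := by
  unfold conformalFactor
  exact contDiffAt_const.div (contDiffAt_const.sub (contDiff_norm_sq ℝ).contDiffAt)
    (one_sub_norm_sq_pos hx).ne'

theorem contDiff_of_forall_mem_tsupport {E F : Type*} [NormedAddCommGroup E] [NormedSpace ℝ E]
    [NormedAddCommGroup F] [NormedSpace ℝ F] {n : WithTop ℕ∞} {f : E → F}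
    (hf : ∀ x ∈ tsupport f, ContDiffAt ℝ n f x) : ContDiff ℝ n f := by
  rw [contDiff_iff_contDiffAt]
  intro x
  by_cases hx : x ∈ tsupport f
  · exact hf x hx
  · exact contDiffAt_const.congr_of_eventuallyEq (notMem_tsupport_iff_eventuallyEq.mp hx)

theorem tsupport_rellichField_subset (u : E4 → ℝ) (i : Fin 4) :
    tsupport (rellichField u i) ⊆ tsupport u := by
  refine closure_minimal (fun x hx => ?_) (isClosed_tsupport u)
  by_contra h
  exact hx (by simp [rellichField, partialDeriv_eq_zero_of_notMem_tsupport h,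
    image_eq_zero_of_notMem_tsupport h])

theorem contDiff_rellichField {u : E4 → ℝ} (hu : ContDiff ℝ (⊤ : ℕ∞) u)
    (hs : tsupport u ⊆ Metric.ball (0 : E4) 1) (i : Fin 4) :
    ContDiff ℝ (⊤ : ℕ∞) (rellichField u i) := by
  refine contDiff_of_forall_mem_tsupport fun x hx => ?_
  have hw := contDiffAt_conformalFactor (hs (tsupport_rellichField_subset u i hx))
  have hp j := (contDiff_partialDeriv hu j).contDiffAt (x := x)
  have hux := hu.contDiffAt (x := x)
  have hX j : ContDiffAt ℝ (⊤ : ℕ∞) (fun y : E4 => y j) x := by fun_prop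
  unfold rellichField
  fun_prop

theorem integral_partialDeriv_eq_zero {f : E4 → ℝ} (hf : ContDiff ℝ 1 f)
    (hc : HasCompactSupport f) (i : Fin 4) : ∫ x, partialDeriv i f x = 0 := by
  have hf' : Integrable (partialDeriv i f) :=
    ((hf.continuous_fderiv (by simp)).clm_apply continuous_const).integrable_of_hasCompactSupport
      (hc.fderiv_apply ℝ _)
  have h := integral_mul_fderiv_eq_neg_fderiv_mul_of_integrable (μ := volume)
    (f := fun _ : E4 => (1 : ℝ)) (g := f) (v := EuclideanSpace.single i 1)
    (by simp) (by simp only [one_mul]; exact hf')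
    (by simpa using hf.continuous.integrable_of_hasCompactSupport hc)
    (fun x _ => by fun_prop) (fun x _ => hf.differentiable (by simp) x)
  simpa [partialDeriv] using h

theorem hasLineDerivAt_partialDeriv {u : E4 → ℝ} {x : E4} (hu : DifferentiableAt ℝ u x)
    (i : Fin 4) :
    HasLineDerivAt ℝ u (partialDeriv i u x) x (EuclideanSpace.single i 1) :=
  hu.hasFDerivAt.hasLineDerivAt _

theorem hasLineDerivAt_coord (x : E4) (i j : Fin 4) :
    HasLineDerivAt ℝ (fun y : E4 => y j) (if j = i then 1 else 0) x
      (EuclideanSpace.single i 1) := by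
  have h := ((EuclideanSpace.proj j : E4 →L[ℝ] ℝ).hasFDerivAt (x := x)).hasLineDerivAt
    (EuclideanSpace.single i 1)
  simpa [Pi.single_apply] using h

theorem hasLineDerivAt_conformalFactor {x : E4} (hx : x ∈ Metric.ball (0 : E4) 1) (i : Fin 4) :
    HasLineDerivAt ℝ conformalFactor (conformalFactor x ^ 2 * x i) x
      (EuclideanSpace.single i 1) := by
  have hpos := (one_sub_norm_sq_pos hx).ne'
  have h1 : HasLineDerivAt ℝ (fun y : E4 => ‖y‖ ^ 2) (2 * x i) x (EuclideanSpace.single i 1) := by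
    have h := ((hasStrictFDerivAt_norm_sq x).hasFDerivAt).hasLineDerivAt
      (EuclideanSpace.single i 1)
    simpa [EuclideanSpace.inner_single_right] using h
  have h2 := (hasDerivAt_const (0 : ℝ) (2 : ℝ)).div (HasDerivAt.const_sub 1 h1)
    (by simpa using hpos)
  refine HasDerivAt.congr_deriv h2 ?_
  simp only [zero_smul, add_zero, zero_mul, zero_sub, conformalFactor]
  field_simp

theorem partialDeriv_rellichField {u : E4 → ℝ} (hu : ContDiff ℝ (⊤ : ℕ∞) u)
    (hs : tsupport u ⊆ Metric.ball (0 : E4) 1) {x : E4} (hx : x ∈ Metric.ball (0 : E4) 1)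
    (i : Fin 4) :
    partialDeriv i (rellichField u i) x =
      -(4 * (conformalFactor x ^ 2 * x i) * (∑ j, x j * partialDeriv j u x) * partialDeriv i u x
        + 4 * conformalFactor x
          * (partialDeriv i u x + ∑ j, x j * partialDeriv i (partialDeriv j u) x)
          * partialDeriv i u x
        + 4 * conformalFactor x * (∑ j, x j * partialDeriv j u x)
          * partialDeriv i (partialDeriv i u) x
        - 2 * (conformalFactor x ^ 2 * x i) * (∑ j, partialDeriv j u x ^ 2) * x i
        - 4 * conformalFactor x
          * (∑ j, partialDeriv j u x * partialDeriv i (partialDeriv j u) x) * x i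
        - 2 * conformalFactor x * (∑ j, partialDeriv j u x ^ 2)
        + 9 * conformalFactor x ^ 3 * x i * u x * partialDeriv i u x
        + 9 / 2 * conformalFactor x ^ 2 * partialDeriv i u x ^ 2
        + 9 / 2 * conformalFactor x ^ 2 * u x * partialDeriv i (partialDeriv i u) x
        + 45 / 4 * conformalFactor x ^ 4 * u x ^ 2 * x i ^ 2
        + 15 / 2 * conformalFactor x ^ 3 * u x * partialDeriv i u x * x i
        + 15 / 4 * conformalFactor x ^ 3 * u x ^ 2) := by
  have hV := hasLineDerivAt_partialDeriv
    ((contDiff_rellichField hu hs i).differentiable (by simp) x) i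
  have hw := hasLineDerivAt_conformalFactor hx i
  have hX := hasLineDerivAt_coord x i
  have hU := hasLineDerivAt_partialDeriv (hu.differentiable (by simp) x) i
  have hp j := hasLineDerivAt_partialDeriv
    ((contDiff_partialDeriv hu j).differentiable (by simp) x) i
  unfold HasLineDerivAt at hV hw hX hU hp
  have hT := HasDerivAt.fun_sum (u := Finset.univ) fun j _ => (hX j).mul (hp j)
  have hP := HasDerivAt.fun_sum (u := Finset.univ) fun j _ => (hp j).pow 2
  have h := (((((hw.const_mul 4).mul hT).mul (hp i)).sub
    (((hw.const_mul 2).mul hP).mul (hX i))).add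
    ((((hw.pow 2).const_mul (9 / 2)).mul hU).mul (hp i))).add
    ((((hw.pow 3).const_mul (15 / 4)).mul (hU.pow 2)).mul (hX i)) |>.neg
  refine (hV.unique h).trans ?_
  simp only [Pi.mul_apply, Pi.pow_apply, zero_smul, add_zero, Finset.sum_add_distrib, ite_mul,
    one_mul, zero_mul, Finset.sum_ite_eq', Finset.mem_univ, if_true, Nat.cast_ofNat,
    mul_assoc (2 : ℝ), ← Finset.mul_sum, Nat.add_one_sub_one, pow_one]
  ring

theorem sum_partialDeriv_rellichField_le {u : E4 → ℝ} (hu : ContDiff ℝ (⊤ : ℕ∞) u)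
    (hs : tsupport u ⊆ Metric.ball (0 : E4) 1) {x : E4} (hx : x ∈ Metric.ball (0 : E4) 1) :
    ∑ i, partialDeriv i (rellichField u i) x
      ≤ lapE u x ^ 2 - 9 * (u x ^ 2 / (1 - ‖x‖ ^ 2) ^ 4) := by
  have hpos := one_sub_norm_sq_pos hx
  have hw0 : 0 < conformalFactor x := div_pos two_pos hpos
  have hu4 : 9 * (u x ^ 2 / (1 - ‖x‖ ^ 2) ^ 4) = 9 / 16 * conformalFactor x ^ 4 * u x ^ 2 := by
    unfold conformalFactor
    field_simp
    norm_num
  have hw : conformalFactor x * (1 - (x 0 ^ 2 + x 1 ^ 2 + x 2 ^ 2 + x 3 ^ 2)) = 2 := by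
    have hn : ‖x‖ ^ 2 = x 0 ^ 2 + x 1 ^ 2 + x 2 ^ 2 + x 3 ^ 2 := by
      simp [EuclideanSpace.real_norm_sq_eq, Fin.sum_univ_four]
    rw [← hn]
    exact div_mul_cancel₀ _ hpos.ne'
  have h10 := partialDeriv_comm hu 1 0 x
  have h20 := partialDeriv_comm hu 2 0 x
  have h30 := partialDeriv_comm hu 3 0 x
  have h21 := partialDeriv_comm hu 2 1 x
  have h31 := partialDeriv_comm hu 3 1 x
  have h32 := partialDeriv_comm hu 3 2 x
  rw [hu4, lapE_eq_sum_partialDeriv]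
  simp only [partialDeriv_rellichField hu hs hx, Fin.sum_univ_four, h10, h20, h30, h21, h31, h32]
  generalize conformalFactor x = w at *
  generalize u x = v at *
  generalize partialDeriv 0 u x = p₀ at *
  generalize partialDeriv 1 u x = p₁ at *
  generalize partialDeriv 2 u x = p₂ at *
  generalize partialDeriv 3 u x = p₃ at *
  generalize partialDeriv 0 (partialDeriv 0 u) x = q₀ at *
  generalize partialDeriv 1 (partialDeriv 1 u) x = q₁ at *
  generalize partialDeriv 2 (partialDeriv 2 u) x = q₂ at *
  generalize partialDeriv 3 (partialDeriv 3 u) x = q₃ at *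
  generalize x 0 = x₀ at *
  generalize x 1 = x₁ at *
  generalize x 2 = x₂ at *
  generalize x 3 = x₃ at *
  have hsq : 0 ≤ (q₀ + q₁ + q₂ + q₃ + 2 * w * (x₀ * p₀ + x₁ * p₁ + x₂ * p₂ + x₃ * p₃)
        + 9 / 4 * w ^ 2 * v) ^ 2
      + 5 / 2 * w ^ 2 * ((p₀ + 3 / 2 * v * w * x₀) ^ 2 + (p₁ + 3 / 2 * v * w * x₁) ^ 2
        + (p₂ + 3 / 2 * v * w * x₂) ^ 2 + (p₃ + 3 / 2 * v * w * x₃) ^ 2)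
      + 15 / 4 * w ^ 3 * v ^ 2 := by positivity
  rw [← sub_nonneg]
  refine hsq.trans_eq ?_
  linear_combination (-2 * w * (p₀ ^ 2 + p₁ ^ 2 + p₂ ^ 2 + p₃ ^ 2) + 45 / 8 * w ^ 3 * v ^ 2) * hw

theorem integrable_sq_div_one_sub_norm_sq {u : E4 → ℝ} (hu : ContDiff ℝ (⊤ : ℕ∞) u)
    (hc : HasCompactSupport u) (hs : tsupport u ⊆ Metric.ball (0 : E4) 1) :
    Integrable fun x => u x ^ 2 / (1 - ‖x‖ ^ 2) ^ 4 := by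
  have hsupp : Function.support (fun x => u x ^ 2 / (1 - ‖x‖ ^ 2) ^ 4) ⊆ tsupport u := by
    intro x hx
    by_contra h
    exact hx (by simp [image_eq_zero_of_notMem_tsupport h])
  refine Continuous.integrable_of_hasCompactSupport ?_ (hc.mono' hsupp)
  refine (contDiff_of_forall_mem_tsupport (n := 0) fun x hx => ?_).continuous
  have hx' := hs (closure_minimal hsupp (isClosed_tsupport u) hx)
  exact ((hu.of_le (by simp)).contDiffAt.pow 2).div
    ((contDiffAt_const.sub (contDiff_norm_sq ℝ).contDiffAt).pow 4)
    (pow_pos (one_sub_norm_sq_pos hx') 4).ne'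

theorem integrable_lapE_sq {u : E4 → ℝ} (hu : ContDiff ℝ (⊤ : ℕ∞) u)
    (hc : HasCompactSupport u) : Integrable fun x => lapE u x ^ 2 := by
  have hcont : Continuous (lapE u) :=
    continuous_finsetSum _ fun i _ =>
      (contDiff_partialDeriv (contDiff_partialDeriv hu i) i).continuous
  refine (hcont.pow 2).integrable_of_hasCompactSupport (hc.mono' fun x hx => ?_)
  by_contra h
  refine hx ?_
  have h2 i : partialDeriv i (partialDeriv i u) x = 0 :=
    partialDeriv_eq_zero_of_notMem_tsupport
      (fun h' => h (tsupport_fderiv_apply_subset ℝ _ h')) i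
  simp [lapE_eq_sum_partialDeriv, h2]

theorem setIntegral_sum_partialDeriv_rellichField {u : E4 → ℝ} (hu : ContDiff ℝ (⊤ : ℕ∞) u)
    (hc : HasCompactSupport u) (hs : tsupport u ⊆ Metric.ball (0 : E4) 1) :
    ∫ x in Metric.ball (0 : E4) 1, ∑ i, partialDeriv i (rellichField u i) x = 0 := by
  have hV i := contDiff_rellichField hu hs i
  have hVc i : HasCompactSupport (rellichField u i) :=
    hc.mono' ((subset_tsupport _).trans (tsupport_rellichField_subset u i))
  rw [setIntegral_eq_integral_of_forall_compl_eq_zero, integral_finsetSum]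
  · exact Finset.sum_eq_zero fun i _ =>
      integral_partialDeriv_eq_zero ((hV i).of_le (by simp)) (hVc i) i
  · exact fun i _ => (contDiff_partialDeriv (hV i) i).continuous.integrable_of_hasCompactSupport
      ((hVc i).fderiv_apply ℝ _)
  · exact fun x hx => Finset.sum_eq_zero fun i _ =>
      partialDeriv_eq_zero_of_notMem_tsupport
        (fun h => hx (hs (tsupport_rellichField_subset u i h))) i

end

theorem hardy_rellich (u : E4 → ℝ) (hu : ContDiff ℝ (⊤ : ℕ∞) u)
    (hc : HasCompactSupport u) (hs : tsupport u ⊆ Metric.ball (0 : E4) 1) :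
    (∫ x in Metric.ball (0 : E4) 1, |lapE u x| ^ 2)
      ≥ 9 * ∫ x in Metric.ball (0 : E4) 1, u x ^ 2 / (1 - ‖x‖ ^ 2) ^ 4 := by
  have hL := (integrable_lapE_sq hu hc).integrableOn (s := Metric.ball (0 : E4) 1)
  have hR := ((integrable_sq_div_one_sub_norm_sq hu hc hs).const_mul 9).integrableOn
    (s := Metric.ball (0 : E4) 1)
  have hD : IntegrableOn (fun x => ∑ i, partialDeriv i (rellichField u i) x)
      (Metric.ball (0 : E4) 1) :=
    (integrable_finsetSum _ fun i _ => (contDiff_partialDeriv (contDiff_rellichField hu hs i)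
      i).continuous.integrable_of_hasCompactSupport ((hc.mono' ((subset_tsupport _).trans
        (tsupport_rellichField_subset u i))).fderiv_apply ℝ _)).integrableOn
  have h := setIntegral_mono_on hD (hL.sub hR) measurableSet_ball
    fun x hx => sum_partialDeriv_rellichField_le hu hs hx
  rw [setIntegral_sum_partialDeriv_rellichField hu hc hs] at h
  simp only [Pi.sub_apply] at h
  rw [integral_sub hL hR, integral_const_mul] at h
  simp only [sq_abs]
  linarith
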